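/- For every p ∈ (0,2) the class H₊² in the Poisson comparison inequality cannot be replaced by the larger class H₊^p, even for n = 1: there exist strictly positive real numbers σ and y, a real-valued random variable X with X ≤ y almost surely, E X = 0 and E X² = σ², and a function f ∈ H₊^p, such that E f(X) > E f(y Π̃_{σ²/y²}). -/

import Mathlib

open MeasureTheory ProbabilityTheory Real

/-- Law of `y * (Π_θ - θ)`. -/
noncomputable def centeredPoissonLaw (θ y : ℝ) : Measure ℝ :=
  (poissonMeasure θ.toNNReal).map (fun n : ℕ => y * ((n : ℝ) - θ))

/-- The class `H₊^α`. -/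
def MemHpos (α : ℝ) (f : ℝ → ℝ) : Prop :=
  ∃ μ : Measure ℝ, ∀ u : ℝ,
    0 ≤ f u ∧
      ENNReal.ofReal (f u) = ∫⁻ t, ENNReal.ofReal (max (u - t) 0 ^ α) ∂μ

open Filter Topology in
/-- A function vanishing at `0` with positive derivative there is positive just to the right. -/
theorem HasDerivAt.exists_pos_of_map_zero {g : ℝ → ℝ} {g' : ℝ} (hg : HasDerivAt g g' 0)
    (hg0 : g 0 = 0) (hg' : 0 < g') : ∃ a, 0 < a ∧ a < 1 ∧ 0 < g a := by
  have h := (hasDerivAt_iff_tendsto_slope_left_right.1 hg).2.eventually (lt_mem_nhds hg')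
  have h1 : ∀ᶠ a in 𝓝[>] (0 : ℝ), a < 1 :=
    nhdsWithin_le_nhds (gt_mem_nhds zero_lt_one)
  obtain ⟨a, ⟨ha, ha1⟩, ha0⟩ := ((h.and h1).and self_mem_nhdsWithin).exists
  have ha0 : 0 < a := ha0
  refine ⟨a, ha0, ha1, ?_⟩
  rw [slope_def_field, hg0, sub_zero, sub_zero] at ha
  exact (div_pos_iff_of_pos_right ha0).1 ha

theorem exists_half_one_add_rpow_lt_mul_rpow {p : ℝ} (hp0 : 0 < p) (hp2 : p < 2) :
    ∃ w : ℝ, 0 < w ∧ w ≤ 1 ∧ (1 + w) ^ p / 2 < p * w ^ (p - 1) := by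
  rcases lt_trichotomy p 1 with hp | rfl | hp
  · refine ⟨p, hp0, hp.le, ?_⟩
    have h := rpow_one_add_lt_one_add_mul_self (s := 1 / p)
      (by linarith [one_div_pos.2 hp0]) (by positivity) hp0 hp
    have h1 : p * p ^ (p - 1) = p ^ p := by
      rw [Real.rpow_sub_one hp0.ne']; field_simp
    have h2 : (1 + p) ^ p = (1 + 1 / p) ^ p * p ^ p := by
      rw [← Real.mul_rpow (by positivity) hp0.le]; congr 1; field_simp; ring
    have h3 : 1 + p * (1 / p) = 2 := by field_simp; norm_num
    rw [h1, h2]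
    nlinarith [Real.rpow_pos_of_pos hp0 p]
  · exact ⟨1 / 2, by norm_num, by norm_num, by norm_num⟩
  · refine ⟨1, one_pos, le_rfl, ?_⟩
    have h := rpow_one_add_lt_one_add_mul_self (s := 1) (p := p - 1)
      (by norm_num) one_ne_zero (by linarith) (by linarith)
    rw [Real.rpow_sub_one (by norm_num)] at h
    rw [Real.one_rpow]
    linarith

/-- Third-order upper bound, as `a → 0`, for exponential series with coefficients `O(4 ^ n)`. -/
theorem tsum_pow_div_factorial_mul_le {g : ℕ → ℝ} (hg0 : ∀ n, 0 ≤ g n) (hg : ∀ n, g n ≤ 4 ^ n)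
    {a : ℝ} (ha0 : 0 ≤ a) (ha1 : a ≤ 1) :
    ∑' n : ℕ, a ^ n / n.factorial * g n ≤
      g 0 + a * g 1 + a ^ 2 / 2 * g 2 +
        a ^ 3 * ∑' n : ℕ, (4 : ℝ) ^ (n + 3) / (n + 3).factorial := by
  have hS : Summable fun n : ℕ => (4 : ℝ) ^ (n + 3) / (n + 3).factorial :=
    (summable_nat_add_iff (f := fun n : ℕ => (4 : ℝ) ^ n / n.factorial) 3).2
      (Real.summable_pow_div_factorial 4)
  have htail (n : ℕ) : a ^ (n + 3) / (n + 3).factorial * g (n + 3) ≤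
      a ^ 3 * ((4 : ℝ) ^ (n + 3) / (n + 3).factorial) := by
    have h1 : a ^ (n + 3) ≤ a ^ 3 := pow_le_pow_of_le_one ha0 ha1 (by omega)
    calc a ^ (n + 3) / (n + 3).factorial * g (n + 3)
        ≤ a ^ 3 / (n + 3).factorial * 4 ^ (n + 3) := by
          gcongr
          · exact hg0 _
          · exact hg _
      _ = _ := by ring
  have hT : Summable fun n : ℕ => a ^ (n + 3) / (n + 3).factorial * g (n + 3) :=
    Summable.of_nonneg_of_le (fun n => mul_nonneg (by positivity) (hg0 _)) htail (hS.mul_left _)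
  have hT' : Summable fun n : ℕ => a ^ n / n.factorial * g n :=
    (summable_nat_add_iff (f := fun n : ℕ => a ^ n / n.factorial * g n) 3).1 hT
  rw [← hT'.sum_add_tsum_nat_add 3, ← tsum_mul_left]
  refine add_le_add (le_of_eq ?_) (hT.tsum_le_tsum htail (hS.mul_left _))
  simp [Finset.sum_range_succ, Nat.factorial]

theorem integral_centeredPoissonLaw {θ : ℝ} (hθ : 0 ≤ θ) (y : ℝ) {f : ℝ → ℝ}
    (hf : Measurable f) :
    ∫ z, f z ∂(centeredPoissonLaw θ y) =
      exp (-θ) * ∑' n : ℕ, θ ^ n / n.factorial * f (y * (n - θ)) := by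
  rw [centeredPoissonLaw, integral_map .of_discrete hf.aestronglyMeasurable,
    integral_poissonMeasure, ← tsum_mul_left]
  simp only [Real.coe_toNNReal _ hθ, smul_eq_mul]
  congr with n
  ring

theorem memHpos_max_sub_rpow (p t : ℝ) : MemHpos p fun u => max (u - t) 0 ^ p :=
  ⟨Measure.dirac t, fun u => ⟨by positivity, by
    rw [lintegral_dirac' _ (by fun_prop)]⟩⟩

/-- The law on `Bool` giving weight `a / (1 + a)` to `true` and `1 / (1 + a)` to `false`. -/
noncomputable def boolOddsLaw (a : ℝ) : Measure Bool :=
  ENNReal.ofReal (a / (1 + a)) • Measure.dirac true +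
    ENNReal.ofReal (1 / (1 + a)) • Measure.dirac false

theorem isProbabilityMeasure_boolOddsLaw {a : ℝ} (ha : 0 ≤ a) :
    IsProbabilityMeasure (boolOddsLaw a) := by
  constructor
  simp only [boolOddsLaw, Measure.add_apply, Measure.smul_apply, measure_univ, smul_eq_mul,
    mul_one]
  rw [← ENNReal.ofReal_add (by positivity) (by positivity), ← ENNReal.ofReal_one]
  congr 1
  field_simp
  ring

theorem integral_boolOddsLaw {a : ℝ} (ha : 0 ≤ a) (f : Bool → ℝ) :
    ∫ ω, f ω ∂(boolOddsLaw a) = (a * f true + f false) / (1 + a) := by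
  rw [boolOddsLaw, integral_add_measure (Integrable.of_finite.smul_measure ENNReal.ofReal_ne_top)
      (Integrable.of_finite.smul_measure ENNReal.ofReal_ne_top), integral_smul_measure,
    integral_smul_measure, integral_dirac, integral_dirac,
    ENNReal.toReal_ofReal (by positivity), ENNReal.toReal_ofReal (by positivity)]
  simp only [smul_eq_mul]
  ring

theorem max_sub_rpow_le_four_pow {p s : ℝ} (hp0 : 0 < p) (hp2 : p < 2) (hs : 0 ≤ s) (n : ℕ) :
    max ((n : ℝ) - s) 0 ^ p ≤ 4 ^ n := by
  have hn : (n : ℝ) + 1 ≤ 2 ^ n := by exact_mod_cast Nat.lt_two_pow_self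
  have hn0 : (0 : ℝ) ≤ n := n.cast_nonneg
  calc max ((n : ℝ) - s) 0 ^ p ≤ ((n : ℝ) + 1) ^ p :=
        Real.rpow_le_rpow (le_max_right _ _) (max_le (by linarith) (by linarith)) hp0.le
    _ ≤ ((n : ℝ) + 1) ^ (2 : ℝ) := Real.rpow_le_rpow_of_exponent_le (by linarith) hp2.le
    _ = ((n : ℝ) + 1) ^ 2 := Real.rpow_two _
    _ ≤ (2 ^ n) ^ 2 := by gcongr
    _ = 4 ^ n := by rw [← pow_mul, mul_comm, pow_mul]; norm_num

/-- For `p ∈ (0,2)` the class `H₊²` cannot be replaced by `H₊^p` in the Poisson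
comparison inequality, even for a single random variable. -/
theorem H2_optimal (p : ℝ) (hp0 : 0 < p) (hp2 : p < 2) :
    ∃ (σ y : ℝ), 0 < σ ∧ 0 < y ∧
      ∃ (Ω : Type) (_ : MeasurableSpace Ω) (μ : Measure Ω)
        (_ : IsProbabilityMeasure μ) (X : Ω → ℝ),
        Measurable X ∧ (∀ᵐ ω ∂μ, X ω ≤ y) ∧
        Integrable (fun ω => X ω ^ 2) μ ∧
        (∫ ω, X ω ∂μ) = 0 ∧ (∫ ω, X ω ^ 2 ∂μ) = σ ^ 2 ∧
        ∃ f : ℝ → ℝ, MemHpos p f ∧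
          ∫ z, f z ∂(centeredPoissonLaw (σ ^ 2 / y ^ 2) y) < ∫ ω, f (X ω) ∂μ := by
  obtain ⟨w, hw0, hw1, hw⟩ := exists_half_one_add_rpow_lt_mul_rpow hp0 hp2
  set K : ℝ := ∑' n : ℕ, (4 : ℝ) ^ (n + 3) / (n + 3).factorial
  obtain ⟨a, ha0, ha1, ha⟩ : ∃ a : ℝ, 0 < a ∧ a < 1 ∧
      0 < (w + a) ^ p - (w ^ p + (1 + w) ^ p / 2 * a + K * a ^ 2) := by
    refine HasDerivAt.exists_pos_of_map_zero
      (g := fun a => (w + a) ^ p - (w ^ p + (1 + w) ^ p / 2 * a + K * a ^ 2))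
      (g' := p * w ^ (p - 1) - (1 + w) ^ p / 2) ?_ (by simp) (by linarith)
    have h1 : HasDerivAt (fun a : ℝ => (w + a) ^ p) (p * w ^ (p - 1)) 0 := by
      have := ((hasDerivAt_id (0 : ℝ)).const_add w).rpow_const (p := p)
        (Or.inl (by simpa using hw0.ne'))
      simpa using this
    have h2 : HasDerivAt (fun a : ℝ => w ^ p + (1 + w) ^ p / 2 * a + K * a ^ 2)
        ((1 + w) ^ p / 2) 0 := by
      have := (((hasDerivAt_id (0 : ℝ)).const_mul ((1 + w) ^ p / 2)).const_add (w ^ p)).add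
        (((hasDerivAt_id (0 : ℝ)).pow 2).const_mul K)
      simpa using! this
    exact h1.sub h2
  have : IsProbabilityMeasure (boolOddsLaw a) := isProbabilityMeasure_boolOddsLaw ha0.le
  refine ⟨√a, 1, Real.sqrt_pos.2 ha0, one_pos, Bool, inferInstance, boolOddsLaw a, this,
    fun b => if b then 1 else -a, .of_discrete, ?_, .of_finite, ?_, ?_,
    fun u => max (u - (1 - w - a)) 0 ^ p, memHpos_max_sub_rpow _ _, ?_⟩
  · refine ae_of_all _ fun b => ?_
    cases b <;> simp
    linarith
  · rw [integral_boolOddsLaw ha0.le]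
    simp
  · rw [integral_boolOddsLaw ha0.le, Real.sq_sqrt ha0.le]
    simp
    field_simp
  · rw [Real.sq_sqrt ha0.le, one_pow, div_one,
      integral_centeredPoissonLaw ha0.le 1 (by fun_prop), integral_boolOddsLaw ha0.le]
    have hsum := tsum_pow_div_factorial_mul_le (g := fun n : ℕ => max ((n : ℝ) - (1 - w)) 0 ^ p)
      (fun n => by positivity)
      (max_sub_rpow_le_four_pow hp0 hp2 (sub_nonneg.2 hw1)) ha0.le ha1.le
    have e (n : ℕ) : (1 : ℝ) * (n - a) - (1 - w - a) = n - (1 - w) := by ring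
    have e0 : max ((0 : ℕ) - (1 - w)) 0 = 0 := max_eq_right (by push_cast; linarith)
    have e1 : max ((1 : ℕ) - (1 - w)) 0 = w := by
      rw [max_eq_left (by push_cast; linarith)]; push_cast; ring
    have e2 : max ((2 : ℕ) - (1 - w)) 0 = 1 + w := by
      rw [max_eq_left (by push_cast; linarith)]; push_cast; ring
    have ef : max (-a - (1 - w - a)) 0 = 0 := max_eq_right (by linarith)
    have et : max (1 - (1 - w - a)) 0 = w + a := by
      rw [max_eq_left (by linarith)]; ring
    simp only [e0, e1, e2, Real.zero_rpow hp0.ne'] at hsum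
    simp only [e, if_true, Bool.false_eq_true, if_false, ef, et, Real.zero_rpow hp0.ne', add_zero]
    set S := ∑' n : ℕ, a ^ n / n.factorial * max ((n : ℝ) - (1 - w)) 0 ^ p
    have hS0 : 0 ≤ S := tsum_nonneg fun n => by positivity
    have hexp : exp (-a) ≤ 1 / (1 + a) := by
      rw [Real.exp_neg, ← one_div]
      exact one_div_le_one_div_of_le (by positivity) (by linarith [Real.add_one_le_exp a])
    calc exp (-a) * S ≤ 1 / (1 + a) * S := by gcongr
      _ = S / (1 + a) := by ring
      _ < a * (w + a) ^ p / (1 + a) := by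
        gcongr
        nlinarith [mul_pos ha0 ha]
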